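/- Let m ≥ 1 and g ≥ 1 be integers, let x be a ruler of length t with m+1 markings, and let z_i = x_i − x_{i−1} for 1 ≤ i ≤ m. Then x is a B_2^-[g]-set if and only if there do not exist consecutive subsets U_0, U_1, ..., U_g of [m], none of which is contained in another, such that Σ_{i∈U_0} z_i = Σ_{i∈U_1} z_i = ... = Σ_{i∈U_g} z_i. -/

import Mathlib

/-- A ruler of length `t` with `m+1` markings, given as `x : ℕ → ℤ` with
`0 = x 0 < x 1 < ⋯ < x m = t`. -/
def IsRuler (m : ℕ) (t : ℤ) (x : ℕ → ℤ) : Prop :=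
  x 0 = 0 ∧ x m = t ∧ ∀ i < m, x i < x (i + 1)

/-- A ruler is a `B_2^-[g]`-set if every positive integer has at most `g` representations
as a difference `x j - x i` with `0 ≤ i < j ≤ m`. -/
def IsB2gMinusSet (m g : ℕ) (x : ℕ → ℤ) : Prop :=
  ∀ n : ℤ, 0 < n → {p : ℕ × ℕ | p.1 < p.2 ∧ p.2 ≤ m ∧ x p.2 - x p.1 = n}.ncard ≤ g

/-- A consecutive subset of `[m] = {1,…,m}`. -/
def IsConsec (m : ℕ) (U : Finset ℕ) : Prop :=
  ∃ i j : ℕ, 1 ≤ i ∧ i ≤ j ∧ j ≤ m ∧ U = Finset.Icc i j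

theorem IsRuler.lt {m : ℕ} {t : ℤ} {x : ℕ → ℤ} (hx : IsRuler m t x) {i j : ℕ}
    (hij : i < j) (hj : j ≤ m) : x i < x j := by
  induction j, hij using Nat.le_induction with
  | base => exact hx.2.2 i hj
  | succ k hk ih => exact (ih (by omega)).trans (hx.2.2 k hj)

theorem IsRuler.le {m : ℕ} {t : ℤ} {x : ℕ → ℤ} (hx : IsRuler m t x) {i j : ℕ}
    (hij : i ≤ j) (hj : j ≤ m) : x i ≤ x j := by
  rcases hij.eq_or_lt with rfl | h
  · exact le_rfl
  · exact (hx.lt h hj).le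

/-- Consecutive sums of successive differences telescope. -/
theorem sum_Icc_successive_differences {m : ℕ} {x z : ℕ → ℤ}
    (hz : ∀ i, 1 ≤ i → i ≤ m → z i = x i - x (i - 1)) {a b : ℕ} (hab : a ≤ b) (hb : b ≤ m) :
    ∑ i ∈ Finset.Icc (a + 1) b, z i = x b - x a := by
  induction b, hab using Nat.le_induction with
  | base => simp
  | succ k hk ih =>
    rw [Finset.sum_Icc_succ_top (by omega), ih (by omega), hz (k + 1) (by omega) hb]
    simp

/-- Two nested intervals of marks of a ruler that measure the same distance are equal. -/
theorem IsRuler.eq_of_Icc_subset {m : ℕ} {t : ℤ} {x : ℕ → ℤ} (hx : IsRuler m t x)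
    {a b c d : ℕ} (hab : a < b) (hd : d ≤ m) (h : x b - x a = x d - x c)
    (hsub : Finset.Icc (a + 1) b ⊆ Finset.Icc (c + 1) d) : a = c ∧ b = d := by
  obtain ⟨hca, hbd⟩ := (Finset.Icc_subset_Icc_iff (by omega)).1 hsub
  have hca' : c ≤ a := by omega
  have h₁ := hx.le hca' (by omega)
  have h₂ := hx.le hbd hd
  constructor
  · by_contra hne
    have := hx.lt (show c < a by omega) (by omega)
    omega
  · by_contra hne
    have := hx.lt (show b < d by omega) hd
    omega

theorem finite_setOf_difference_eq (m : ℕ) (x : ℕ → ℤ) (n : ℤ) :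
    {p : ℕ × ℕ | p.1 < p.2 ∧ p.2 ≤ m ∧ x p.2 - x p.1 = n}.Finite := by
  refine (Finset.range (m + 1) ×ˢ Finset.range (m + 1)).finite_toSet.subset ?_
  rintro ⟨a, b⟩ ⟨h₁, h₂, -⟩
  simp only [Finset.coe_product, Set.mem_prod, Finset.coe_range, Set.mem_Iio] at *
  omega

/-- A ruler `x` with successive differences `z` is a `B_2^-[g]`-set iff there do not exist
consecutive subsets `U 0, …, U g` of `[m]`, none contained in another, with
`Σ_{i∈U 0} z_i = Σ_{i∈U 1} z_i = ⋯ = Σ_{i∈U g} z_i`. -/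
theorem isB2gMinusSet_iff_avoids_subspaces (m g : ℕ) (hm : 1 ≤ m) (hg : 1 ≤ g)
    (t : ℤ) (x z : ℕ → ℤ) (hx : IsRuler m t x)
    (hz : ∀ i, 1 ≤ i → i ≤ m → z i = x i - x (i - 1)) :
    IsB2gMinusSet m g x ↔
      ¬ ∃ U : ℕ → Finset ℕ,
        (∀ k ≤ g, IsConsec m (U k)) ∧
        (∀ k ≤ g, ∀ k' ≤ g, k ≠ k' → ¬ U k ⊆ U k') ∧
        (∀ k ≤ g, ∑ i ∈ U k, z i = ∑ i ∈ U 0, z i) := by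
  constructor
  · rintro hB ⟨U, hU, hne, hsum⟩
    have hpair : ∀ k, ∃ p : ℕ × ℕ,
        k ≤ g → p.1 < p.2 ∧ p.2 ≤ m ∧ U k = Finset.Icc (p.1 + 1) p.2 := by
      intro k
      by_cases hk : k ≤ g
      · obtain ⟨i, j, hi, hij, hj, h⟩ := hU k hk
        refine ⟨(i - 1, j), fun _ => ⟨by dsimp only; omega, hj, ?_⟩⟩
        rw [h, Nat.sub_add_cancel hi]
      · exact ⟨(0, 0), fun h => absurd h hk⟩
    choose p hp using hpair
    have hval : ∀ k ≤ g, ∑ i ∈ U k, z i = x (p k).2 - x (p k).1 := by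
      intro k hk
      obtain ⟨h₁, h₂, h₃⟩ := hp k hk
      rw [h₃, sum_Icc_successive_differences hz h₁.le h₂]
    have h0 := hp 0 (Nat.zero_le g)
    have hpos := hx.lt h0.1 h0.2.1
    have hcard := hB (x (p 0).2 - x (p 0).1) (by omega)
    have hle : ((Finset.range (g + 1)).image p).card ≤ g := by
      rw [← Set.ncard_coe_finset]
      refine (Set.ncard_le_ncard ?_ (finite_setOf_difference_eq m x _)).trans hcard
      intro q hq
      obtain ⟨k, hk, rfl⟩ := Finset.mem_image.1 (Finset.mem_coe.1 hq)
      have hk' : k ≤ g := Nat.lt_succ_iff.1 (Finset.mem_range.1 hk)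
      refine ⟨(hp k hk').1, (hp k hk').2.1, ?_⟩
      rw [← hval k hk', ← hval 0 (Nat.zero_le g), hsum k hk']
    rw [Finset.card_image_of_injOn, Finset.card_range] at hle
    · omega
    · intro k hk l hl hkl
      have hk' : k ≤ g := Nat.lt_succ_iff.1 (Finset.mem_range.1 (Finset.mem_coe.1 hk))
      have hl' : l ≤ g := Nat.lt_succ_iff.1 (Finset.mem_range.1 (Finset.mem_coe.1 hl))
      by_contra h
      refine hne k hk' l hl' h ?_
      rw [(hp k hk').2.2, (hp l hl').2.2, hkl]
  · intro hU n _
    by_contra! hlt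
    rw [Set.ncard_eq_toFinset_card _ (finite_setOf_difference_eq m x n)] at hlt
    set S := (finite_setOf_difference_eq m x n).toFinset
    let p : ℕ → ℕ × ℕ := fun k => if h : k < S.card then S.equivFin.symm ⟨k, h⟩ else (0, 0)
    have hpS : ∀ k ≤ g, (p k).1 < (p k).2 ∧ (p k).2 ≤ m ∧ x (p k).2 - x (p k).1 = n := by
      intro k hk
      have hmem : p k ∈ S := by simp [p, show k < S.card by omega]
      simpa [S] using hmem
    have hinj : ∀ k ≤ g, ∀ l ≤ g, p k = p l → k = l := by
      intro k hk l hl h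
      simpa [p, show k < S.card by omega, show l < S.card by omega, Subtype.coe_inj] using h
    have hsum : ∀ k ≤ g, ∑ i ∈ Finset.Icc ((p k).1 + 1) (p k).2, z i = n := by
      intro k hk
      obtain ⟨h₁, h₂, h₃⟩ := hpS k hk
      rw [sum_Icc_successive_differences hz h₁.le h₂, h₃]
    refine hU ⟨fun k => Finset.Icc ((p k).1 + 1) (p k).2, ?_, ?_, ?_⟩
    · intro k hk
      obtain ⟨h₁, h₂, -⟩ := hpS k hk
      exact ⟨_, _, by omega, h₁, h₂, rfl⟩
    · intro k hk l hl hkl hsub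
      obtain ⟨h₁, -, h₃⟩ := hpS k hk
      obtain ⟨-, h₅, h₆⟩ := hpS l hl
      obtain ⟨ha, hb⟩ := hx.eq_of_Icc_subset h₁ h₅ (h₃.trans h₆.symm) hsub
      exact hkl (hinj k hk l hl (Prod.ext ha hb))
    · intro k hk
      exact (hsum k hk).trans (hsum 0 (Nat.zero_le g)).symm
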